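/- arXiv:2407.05430 — 3 statements merged into one kernel-verified Lean document; each statement's English description precedes it below -/
import Mathlib

section
/- (Lemma 4.3 of the paper.) Let x be a natural number and let f, g : Fin x → Bool. With the encodings encA, encB : Bool → Fin 3 given by encA(true) = encB(true) = 0, encA(false) = 1, encB(false) = 2, one has |{k ∈ Fin x : encA(f k) ≠ encB(g k)}| < x if and only if there exists k ∈ Fin x with f k = true and g k = true. Equivalently, the (i,j) entry of the Boolean matrix product AB equals 1 if and only if the Hamming distance between the encoded i-th row of A and the encoded j-th column of B is strictly less than x. -/
/-- Encoding of entries of the matrix `A`: `1 ↦ '1'`, `0 ↦ 'x'`. -/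
def encA : Bool → Fin 3 := fun a => if a then 0 else 1

/-- Encoding of entries of the matrix `B`: `1 ↦ '1'`, `0 ↦ 'y'`. -/
def encB : Bool → Fin 3 := fun b => if b then 0 else 2

theorem encA_eq_encB_iff (a b : Bool) : encA a = encB b ↔ a = true ∧ b = true := by
  revert a b
  decide

theorem mismatch_count_lt_iff (x : ℕ) (f g : Fin x → Bool) :
    (Finset.univ.filter (fun k : Fin x => encA (f k) ≠ encB (g k))).card < x ↔
      ∃ k : Fin x, f k = true ∧ g k = true := by
  have h := Finset.card_lt_iff_ne_univ
    (Finset.univ.filter (fun k : Fin x => encA (f k) ≠ encB (g k)))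
  rw [Fintype.card_fin] at h
  rw [h]
  simp [encA_eq_encB_iff, Finset.eq_univ_iff_forall]
end

section
/- Full correctness of the ternary reduction in Theorem 4.2: let r, c, x be natural numbers, A : Fin r → Fin x → Bool and B : Fin x → Fin c → Bool Boolean matrices. Let S be the list over Fin 3 obtained by concatenating, for i = 0, …, r−1, the encoded rows (encA(A i 0), …, encA(A i (x−1))), and let T be the concatenation, for j = 0, …, c−1, of the encoded columns (encB(B 0 j), …, encB(B (x−1) j)), where encA(true) = encB(true) = 0, encA(false) = 1, encB(false) = 2. Then |S| = r·x, |T| = c·x, and for all i < r and j < c: HD((S.drop (i·x)).take x, (T.drop (j·x)).take x) < x if and only if there exists k ∈ Fin x with A i k = true and B k j = true. Hence every entry of the Boolean product AB is determined by one substring-Hamming-distance query on S and T. -/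
/-- Truncated Hamming distance: number of indices `k < min |s| |t|` with `s[k] ≠ t[k]`. -/
def HD {α : Type*} [DecidableEq α] (s t : List α) : ℕ :=
  ((s.zip t).filter (fun p => p.1 ≠ p.2)).length

theorem List.take_drop_flatMap_of_length_eq {α β : Type*} {f : α → List β} {x : ℕ}
    (hf : ∀ a, (f a).length = x) (l : List α) (i : ℕ) (hi : i < l.length) :
    ((l.flatMap f).drop (i * x)).take x = f l[i] := by
  induction l generalizing i with
  | nil => simp at hi
  | cons a l ih =>
    cases i with
    | zero => simp [← hf a]
    | succ i =>
      have hdrop : (f a ++ l.flatMap f).drop ((i + 1) * x) = (l.flatMap f).drop (i * x) := by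
        rw [Nat.succ_mul, Nat.add_comm, ← hf a, List.drop_append]
        simp
      rw [List.flatMap_cons, hdrop, ih i (by simpa using hi)]
      simp

theorem HD_map_lt_length_iff {ι α : Type*} [DecidableEq α] (l : List ι) (f g : ι → α) :
    HD (l.map f) (l.map g) < l.length ↔ ∃ k ∈ l, f k = g k := by
  have hzip : (l.map f).zip (l.map g) = l.map (fun k => (f k, g k)) := by
    simp [List.zip_map']
  have hlen : l.length = ((l.map f).zip (l.map g)).length := by simp
  rw [HD, hlen, List.length_filter_lt_length_iff_exists, hzip]
  simp

theorem ternary_reduction_correct (r c x : ℕ)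
    (A : Fin r → Fin x → Bool) (B : Fin x → Fin c → Bool)
    (S T : List (Fin 3))
    (hS : S = (List.finRange r).flatMap
      (fun i => (List.finRange x).map (fun k => encA (A i k))))
    (hT : T = (List.finRange c).flatMap
      (fun j => (List.finRange x).map (fun k => encB (B k j)))) :
    S.length = r * x ∧ T.length = c * x ∧
      ∀ (i : Fin r) (j : Fin c),
        HD ((S.drop (i.val * x)).take x) ((T.drop (j.val * x)).take x) < x ↔
          ∃ k : Fin x, A i k = true ∧ B k j = true := by
  subst hS hT
  have hA : ∀ i, ((List.finRange x).map (fun k => encA (A i k))).length = x := by simp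
  have hB : ∀ j, ((List.finRange x).map (fun k => encB (B k j))).length = x := by simp
  refine ⟨?_, ?_, fun i j => ?_⟩
  · simp
  · simp
  · rw [List.take_drop_flatMap_of_length_eq hA _ _ (by simp),
      List.take_drop_flatMap_of_length_eq hB _ _ (by simp)]
    simpa [encA_eq_encB_iff] using HD_map_lt_length_iff (List.finRange x)
      (fun k => encA (A i k)) (fun k => encB (B k j))
end

section
/- Binary-alphabet version of Lemma 4.3: let x be a natural number and f, g : Fin x → Bool. Encode the row f as the Boolean list R = concat over k of E(encA(f k)) and the column g as C = concat over k of E(encB(g k)), where encA(true) = encB(true) = 0, encA(false) = 1, encB(false) = 2, and E : Fin 3 → List Bool is E(0) = [0,1,1], E(1) = [1,0,1], E(2) = [1,1,0]. Then |R| = |C| = 3x and HD(R, C) < 2x if and only if there exists k ∈ Fin x with f k = true and g k = true. Hence the Boolean matrix product can be recovered from Hamming distance queries on binary strings by comparing against the threshold 2x. -/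
/-- Binary codewords `'011'`, `'101'`, `'110'` for the three characters. -/
def E : Fin 3 → List Bool
  | 0 => [false, true, true]
  | 1 => [true, false, true]
  | 2 => [true, true, false]

theorem HD_append {α : Type*} [DecidableEq α] {s t : List α} (s' t' : List α)
    (h : s.length = t.length) : HD (s ++ s') (t ++ t') = HD s t + HD s' t' := by
  simp [HD, List.zip_append h]

theorem length_E (c : Fin 3) : (E c).length = 3 := by
  fin_cases c <;> rfl

theorem length_flatMap_E {ι : Type*} (c : ι → Fin 3) (l : List ι) :
    (l.flatMap fun k => E (c k)).length = 3 * l.length := by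
  simp [List.length_flatMap, length_E, mul_comm]

theorem HD_E_encA_encB (a b : Bool) :
    HD (E (encA a)) (E (encB b)) = if a && b then 0 else 2 := by
  cases a <;> cases b <;> decide

/-- Each position at which both rows are `true` lowers the distance by exactly `2`. -/
theorem HD_flatMap_add_countP {ι : Type*} (f g : ι → Bool) (l : List ι) :
    HD (l.flatMap fun k => E (encA (f k))) (l.flatMap fun k => E (encB (g k)))
      + 2 * l.countP (fun k => f k && g k) = 2 * l.length := by
  induction l with
  | nil => rfl
  | cons k l ih =>
    rw [List.flatMap_cons, List.flatMap_cons, HD_append _ _ (by simp [length_E]),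
      HD_E_encA_encB, List.countP_cons, List.length_cons]
    split_ifs <;> omega

theorem binary_reduction_lt_iff (x : ℕ) (f g : Fin x → Bool)
    (R C : List Bool)
    (hR : R = (List.finRange x).flatMap (fun k => E (encA (f k))))
    (hC : C = (List.finRange x).flatMap (fun k => E (encB (g k)))) :
    R.length = 3 * x ∧ C.length = 3 * x ∧
      (HD R C < 2 * x ↔ ∃ k : Fin x, f k = true ∧ g k = true) := by
  subst hR hC
  refine ⟨by rw [length_flatMap_E (fun k => encA (f k)), List.length_finRange],
    by rw [length_flatMap_E (fun k => encB (g k)), List.length_finRange], ?_⟩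
  have hcount := HD_flatMap_add_countP f g (List.finRange x)
  rw [List.length_finRange] at hcount
  have hpos : 0 < (List.finRange x).countP (fun k => f k && g k) ↔
      ∃ k : Fin x, f k = true ∧ g k = true := by
    simp [List.countP_pos_iff]
  rw [← hpos]
  omega
end
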